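/- Let p be a prime, q = p^r with r ≥ 1, m ≥ 2, and let f ∈ 𝔽_{q^m}(z) be a nonconstant rational function. If #D(f) = q, then e(f) ≥ r, i.e., the p-linear degree of f is at least r. -/

import Mathlib

open Polynomial

/-- The natural embedding `RatFunc K →+* RatFunc L` induced by a field embedding `K →+* L`. -/
noncomputable def ratFuncMap {K L : Type} [Field K] [Field L] (φ : K →+* L) :
    RatFunc K →+* RatFunc L :=
  RatFunc.mapRingHom (Polynomial.mapRingHom φ) (by
    intro q hq
    simp only [Submonoid.mem_comap, coe_mapRingHom]
    rw [mem_nonZeroDivisors_iff_ne_zero] at hq ⊢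
    exact (Polynomial.map_ne_zero_iff φ.injective).mpr hq)

/-- `f` can be written as `a₀ + ∑_{i=0}^{e} aᵢ h^{pⁱ}` with top coefficient nonzero. -/
def HasPRep (p : ℕ) {K : Type} [Field K] (f : RatFunc K) (e : ℕ) : Prop :=
  ∃ (h : RatFunc K) (a₀ : K) (a : ℕ → K), a e ≠ 0 ∧
    f = RatFunc.C a₀ + ∑ i ∈ Finset.range (e + 1), RatFunc.C (a i) * h ^ p ^ i

lemma ratFuncMap_div {K L : Type} [Field K] [Field L] (φ : K →+* L) (a b : K[X]) :
    ratFuncMap φ (algebraMap _ _ a / algebraMap _ _ b) =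
      algebraMap _ _ (a.map φ) / algebraMap _ _ (b.map φ) := by
  unfold ratFuncMap
  rw [RatFunc.coe_mapRingHom_eq_coe_map, RatFunc.map_apply_div]
  rfl

lemma ratFuncMap_C {K L : Type} [Field K] [Field L] (φ : K →+* L) (a : K) :
    ratFuncMap φ (RatFunc.C a) = RatFunc.C (φ a) := by
  have h := ratFuncMap_div φ (C a) 1
  simpa using h

lemma fixed_mem {F R : Type} [Field F] [Fintype F] [Field R] (ψ : F →+* R) (x : R)
    (hx : x ^ Fintype.card F = x) : ∃ y, ψ y = x := by
  classical
  by_contra hne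
  have hne0 := FiniteField.X_pow_card_sub_X_ne_zero R (Fintype.one_lt_card (α := F))
  have h := Polynomial.card_le_degree_of_subset_roots
    (Z := insert x (Finset.univ.image ψ)) (p := (X ^ Fintype.card F - X : R[X])) (by
    intro z hz
    rw [Finset.mem_val, Finset.mem_insert, Finset.mem_image] at hz
    rw [mem_roots hne0]
    rcases hz with rfl | ⟨y, -, rfl⟩
    · simp [hx]
    · simp [← map_pow, FiniteField.pow_card])
  rw [FiniteField.X_pow_card_sub_X_natDegree_eq R (Fintype.one_lt_card (α := F)),
    Finset.card_insert_of_notMem (by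
      simp only [Finset.mem_image, Finset.mem_univ, true_and]; exact hne),
    Finset.card_image_of_injective _ ψ.injective, Finset.card_univ] at h
  omega

lemma exists_g {F R : Type} [Field F] [Fintype F] [Field R] (p r : ℕ) (hp : p.Prime)
    (hr : 1 ≤ r) [CharP R p] (hF : Fintype.card F = p ^ r) (ψ : F →+* R) (f : R)
    (H : ∀ y, ∃ h : R, ψ y * f = h ^ p - h) : ∃ g, f = g - g ^ p ^ r := by
  classical
  have : Fact p.Prime := ⟨hp⟩
  choose h hh using H
  have key : ∀ y (n : ℕ), h y ^ p ^ n = h y + ∑ i ∈ Finset.range n, (ψ y * f) ^ p ^ i := by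
    intro y n
    induction n with
    | zero => simp
    | succ n ih =>
      rw [Finset.sum_range_succ, ← add_assoc, ← ih, hh y, sub_pow_char_pow, ← pow_mul,
        ← pow_succ']
      ring
  refine ⟨∑ y, ψ y⁻¹ * h y, ?_⟩
  have e1 : (∑ y, ψ y⁻¹ * h y) ^ p ^ r = ∑ y, ψ y⁻¹ * h y +
      ∑ i ∈ Finset.range r, f ^ p ^ i * ψ (∑ y, y⁻¹ * y ^ p ^ i) := by
    rw [sum_pow_char_pow]
    simp_rw [map_sum, Finset.mul_sum]
    rw [Finset.sum_comm, ← Finset.sum_add_distrib]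
    refine Finset.sum_congr rfl fun y _ => ?_
    rw [mul_pow, key, ← map_pow, ← hF, FiniteField.pow_card, mul_add, Finset.mul_sum]
    congr 1
    refine Finset.sum_congr rfl fun i _ => ?_
    rw [map_mul, map_pow, mul_pow]
    ring
  have e2 : ∑ i ∈ Finset.range r, f ^ p ^ i * ψ (∑ y, y⁻¹ * y ^ p ^ i) = - f := by
    rw [Finset.sum_eq_single 0]
    · have : ∑ y : F, y⁻¹ * y ^ p ^ 0 = -1 := by
        have h1 : ∀ y : F, y⁻¹ * y ^ p ^ 0 = 1 - if y = 0 then 1 else 0 := by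
          intro y
          by_cases hy : y = 0 <;> simp [hy]
        simp_rw [h1]
        simp
      rw [this]; simp
    · intro i hi h0
      have hlt : p ^ i < p ^ r := Nat.pow_lt_pow_right hp.one_lt (Finset.mem_range.mp hi)
      have h1 : 1 < p ^ i := Nat.one_lt_pow h0 hp.one_lt
      have : ∑ y : F, y⁻¹ * y ^ p ^ i = 0 := by
        rw [← FiniteField.sum_pow_lt_card_sub_one F (p ^ i - 1) (by omega)]
        refine Finset.sum_congr rfl fun y _ => ?_
        by_cases hy : y = 0
        · subst hy
          rw [zero_pow (by omega), zero_pow (by omega), mul_zero]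
        · obtain ⟨k, hk⟩ : ∃ k, p ^ i = k + 1 := ⟨p ^ i - 1, by omega⟩
          rw [hk, pow_succ']
          simp [hy]
      rw [this]; simp
    · intro h; exact absurd (Finset.mem_range.mpr (by omega)) h
  rw [e1, e2]; ring

lemma poly_descend {K L : Type} [Field K] [Fintype K] [Field L] (i : K →+* L) (σ : L →+* L)
    (hσ : ∀ x, σ x = x ^ Fintype.card K) (P : L[X]) (hP : P.map σ = P) :
    ∃ Q : K[X], Q.map i = P := by
  rw [← Polynomial.mem_lifts, Polynomial.lifts_iff_coeff_lifts]
  intro n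
  have := congrArg (fun P => P.coeff n) hP
  simp only [coeff_map, hσ] at this
  exact fixed_mem i _ this

lemma descend {K L : Type} [Field K] [Fintype K] [Field L] (i : K →+* L) (σ : L →+* L)
    (hσ : ∀ x, σ x = x ^ Fintype.card K) (g : RatFunc L) (hg : ratFuncMap σ g = g) :
    ∃ h, ratFuncMap i h = g := by
  have h0 := RatFunc.denom_ne_zero g
  have h1 : g.denom.map σ ≠ 0 := (Polynomial.map_ne_zero_iff σ.injective).mpr h0
  have hm := RatFunc.monic_denom g
  have hc := RatFunc.isCoprime_num_denom g
  have hc' : IsCoprime (g.num.map σ) (g.denom.map σ) := hc.map (Polynomial.mapRingHom σ)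
  have e : algebraMap L[X] (RatFunc L) (g.num.map σ) / algebraMap _ _ (g.denom.map σ) =
      algebraMap _ _ g.num / algebraMap _ _ g.denom := by
    rw [← ratFuncMap_div, RatFunc.num_div_denom, hg]
  rw [div_eq_div_iff (RatFunc.algebraMap_ne_zero h1) (RatFunc.algebraMap_ne_zero h0),
    ← map_mul, ← map_mul] at e
  have e := RatFunc.algebraMap_injective L e
  have hd : g.denom.map σ = g.denom := by
    apply Polynomial.eq_of_monic_of_associated (hm.map σ) hm
    apply associated_of_dvd_dvd
    · exact hc'.symm.dvd_of_dvd_mul_left (by rw [e]; exact dvd_mul_left _ _)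
    · exact hc.symm.dvd_of_dvd_mul_left (by rw [← e]; exact dvd_mul_left _ _)
  have hn : g.num.map σ = g.num := by
    rw [hd] at e
    exact mul_right_cancel₀ h0 e
  obtain ⟨N, hN⟩ := poly_descend i σ hσ _ hn
  obtain ⟨D, hD⟩ := poly_descend i σ hσ _ hd
  refine ⟨algebraMap _ _ N / algebraMap _ _ D, ?_⟩
  rw [ratFuncMap_div, hN, hD, RatFunc.num_div_denom]

lemma artin_solve {L : Type} [Field L] [IsAlgClosed L] (n : ℕ) (hn : 1 < n) (c : L) :
    ∃ b : L, b ^ n - b = c := by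
  have hd : (X ^ n - X - C c : L[X]).degree = n := by
    rw [sub_sub]
    rw [degree_sub_eq_left_of_degree_lt, degree_X_pow]
    rw [degree_X_pow, degree_X_add_C]
    exact_mod_cast hn
  obtain ⟨b, hb⟩ := IsAlgClosed.exists_root (X ^ n - X - C c : L[X]) (by
    rw [hd]; exact_mod_cast (by omega))
  refine ⟨b, ?_⟩
  simp [IsRoot] at hb
  exact sub_eq_zero.mp hb

/-- For nonconstant `f ∈ 𝔽_{q^m}(z)`, if `#D(f) = q = p^r` then the
`p`-linear degree of `f` is at least `r`. -/
theorem stmt_7 (p r m : ℕ) (hp : p.Prime) (hr : 1 ≤ r) (hm : 2 ≤ m)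
    (F K : Type) [Field F] [Field K] [Algebra F K] [Fintype F] [Fintype K]
    (hF : Fintype.card F = p ^ r) (hK : Fintype.card K = (p ^ r) ^ m)
    (f : RatFunc K) (hf : ∀ c : K, f ≠ RatFunc.C c)
    (hD : {y : F | ∃ h : RatFunc (AlgebraicClosure K),
        ratFuncMap (algebraMap K (AlgebraicClosure K))
          (RatFunc.C (algebraMap F K y) * f) = h ^ p - h}.ncard = p ^ r) :
    ∃ e : ℕ, r ≤ e ∧ HasPRep p f e := by
  classical
  have : Fact p.Prime := ⟨hp⟩
  have hK' : Fintype.card K = p ^ (r * m) := by rw [hK, pow_mul]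
  have : CharP K p := charP_of_card_eq_prime_pow hK'
  have : CharP (AlgebraicClosure K) p :=
    charP_of_injective_algebraMap (algebraMap K (AlgebraicClosure K)).injective p
  have : CharP (RatFunc (AlgebraicClosure K)) p :=
    charP_of_injective_ringHom (RatFunc.C (K := AlgebraicClosure K)).injective p
  generalize hi : algebraMap K (AlgebraicClosure K) = i at *
  have hall := Set.eq_of_subset_of_ncard_le (Set.subset_univ _)
    (by rw [hD, Set.ncard_univ, Nat.card_eq_fintype_card, hF]) (Set.toFinite _)
  set ψ : F →+* RatFunc (AlgebraicClosure K) :=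
    RatFunc.C.comp (i.comp (algebraMap F K)) with hψ
  obtain ⟨g, hg⟩ := exists_g p r hp hr hF ψ (ratFuncMap i f) (by
    intro y
    have hy : y ∈ (Set.univ : Set F) := Set.mem_univ y
    rw [← hall] at hy
    obtain ⟨h, hh⟩ := hy
    refine ⟨h, ?_⟩
    rw [← hh, map_mul, ratFuncMap_C]
    rfl)
  set σ := iterateFrobenius (AlgebraicClosure K) p (r * m) with hσd
  have hσ : ∀ x, σ x = x ^ Fintype.card K := by
    intro x; rw [hσd, iterateFrobenius_def, hK']
  have hfix : ∀ u : RatFunc K, ratFuncMap σ (ratFuncMap i u) = ratFuncMap i u := by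
    intro u
    have hpoly : ∀ P : K[X], (P.map i).map σ = P.map i := by
      intro P
      rw [Polynomial.map_map]
      congr 1
      ext x
      rw [RingHom.comp_apply, hσ, ← map_pow, FiniteField.pow_card]
    rw [← RatFunc.num_div_denom u, ratFuncMap_div, ratFuncMap_div, hpoly, hpoly]
  obtain ⟨y, hy⟩ := fixed_mem ψ (ratFuncMap σ g - g) (by
    rw [hF, sub_pow_char_pow]
    have h1 := congrArg (ratFuncMap σ) hg
    rw [hfix, map_sub, map_pow, hg] at h1
    linear_combination h1)
  have hcard : 1 < Fintype.card K := Fintype.one_lt_card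
  obtain ⟨b, hb⟩ := artin_solve (Fintype.card K) hcard (i (algebraMap F K y))
  rw [← hσ] at hb
  have hy' : RatFunc.C (i (algebraMap F K y)) = ratFuncMap σ g - g := hy
  obtain ⟨h, hh⟩ := descend i σ hσ (g - RatFunc.C b) (by
    rw [map_sub, ratFuncMap_C]
    rw [← hb, map_sub] at hy'
    linear_combination -hy')
  have e1 : ratFuncMap i (f - h + h ^ p ^ r) = RatFunc.C (b - b ^ p ^ r) := by
    rw [map_add, map_sub, map_pow, hh, hg, sub_pow_char_pow, map_sub, map_pow]
    ring
  have e2 : σ (b - b ^ p ^ r) = b - b ^ p ^ r := by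
    apply (RatFunc.C (K := AlgebraicClosure K)).injective
    rw [← ratFuncMap_C, ← e1, hfix]
  rw [hσ] at e2
  obtain ⟨a₀, ha⟩ := fixed_mem i _ e2
  have e3 : f - h + h ^ p ^ r = RatFunc.C a₀ := by
    apply (ratFuncMap i).injective
    rw [e1, ratFuncMap_C, ha]
  refine ⟨r, le_rfl, h, a₀, fun j => if j = 0 then 1 else if j = r then -1 else 0, ?_, ?_⟩
  · have : r ≠ 0 := by omega
    simp [this]
  · rw [Finset.sum_range_succ, Finset.sum_eq_single 0]
    · have : r ≠ 0 := by omega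
      simp [this]
      linear_combination e3
    · intro j hj h0
      have : j ≠ r := (Finset.mem_range.mp hj).ne
      simp [h0, this]
    · intro hj; exact absurd (Finset.mem_range.mpr (by omega)) hj
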